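/- arXiv:2405.00902 — 12 statements merged into one kernel-verified Lean document; each statement's English description precedes it below -/
import Mathlib

section
/- Let U ≥ 3 be a natural number and let δ, σ_e, σ_w, T be real numbers with 0 < δ ≤ 1/6, σ_e > 0, σ_w > 0, T > 0. Set m = U − 1 (as a real) and λ = T·σ_w²/σ_e². If δ ≥ (m² − 1)·(2 − δ) / ((1 + λ/U²)·(m + 1)²), then T ≥ U²·σ_e² / (6·σ_w²·δ). -/
theorem stmt_0 (U : ℕ) (hU : 3 ≤ U) (δ σe σw T : ℝ)
    (hδ0 : 0 < δ) (hδ1 : δ ≤ 1/6) (hσe : 0 < σe) (hσw : 0 < σw) (hT : 0 < T)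
    (m : ℝ) (hm : m = (U : ℝ) - 1)
    (lam : ℝ) (hlam : lam = T * σw ^ 2 / σe ^ 2)
    (h : δ ≥ (m ^ 2 - 1) * (2 - δ) / ((1 + lam / (U : ℝ) ^ 2) * (m + 1) ^ 2)) :
    T ≥ (U : ℝ) ^ 2 * σe ^ 2 / (6 * σw ^ 2 * δ) := by
  have hU3 : (3 : ℝ) ≤ U := by exact_mod_cast hU
  have hU0 : (0 : ℝ) < U := by linarith
  obtain ⟨x, hx⟩ : ∃ x, x = lam / (U : ℝ) ^ 2 := ⟨_, rfl⟩
  have hx0 : 0 < x := by rw [hx, hlam]; positivity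
  have hTx : T * σw ^ 2 = x * (U : ℝ) ^ 2 * σe ^ 2 := by
    rw [hx, hlam]; field_simp
  have hm1 : m + 1 = U := by linarith
  have hm2 : m ^ 2 - 1 = U * (U - 2) := by rw [hm]; ring
  rw [← hx, hm1, hm2, ge_iff_le, div_le_iff₀ (by positivity)] at h
  have h_lin : ((U : ℝ) - 2) * (2 - δ) ≤ δ * (1 + x) * U :=
    le_of_mul_le_mul_left (by linarith) hU0
  have h_third : (U : ℝ) * ((2 - δ) / 3) ≤ (U - 2) * (2 - δ) := by
    nlinarith [mul_nonneg (sub_nonneg.2 hU3) (show (0 : ℝ) ≤ 2 - δ by linarith)]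
  have h_ratio : (2 - δ) / 3 ≤ δ * (1 + x) :=
    le_of_mul_le_mul_left (by linarith) hU0
  have hδx : 1 ≤ 6 * (δ * x) := by linarith
  rw [ge_iff_le, div_le_iff₀ (by positivity)]
  calc (U : ℝ) ^ 2 * σe ^ 2 ≤ 6 * (δ * x) * ((U : ℝ) ^ 2 * σe ^ 2) :=
        le_mul_of_one_le_left (by positivity) hδx
    _ = 6 * δ * (x * (U : ℝ) ^ 2 * σe ^ 2) := by ring
    _ = T * (6 * σw ^ 2 * δ) := by rw [← hTx]; ring
end

section
/- Let U ≥ 2 be a natural number, set m = U − 1 (as a real), and let λ, r, δ be reals with λ > 0, r > 0, 0 < δ < 1. Define f0 = 1/U², f1 = 2m/U², f2 = m²/U². Then the inequality r·δ ≥ (f2/f0 − 1) · (m²/(f2·λ + m²)) · r·(2 − δ) / (1 + 2·f2·(f1·λ + 2m)·m/(f1·(f2·λ + m²)) + f2·(f0·λ + 1)·m²/(f0·(f2·λ + m²))) holds if and only if δ ≥ (m² − 1)·(2 − δ) / ((1 + λ/U²)·(m + 1)²). -/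
theorem stmt_1 (U : ℕ) (hU : 2 ≤ U) (m lam r δ : ℝ)
    (hm : m = (U : ℝ) - 1) (hlam : 0 < lam) (hr : 0 < r) (hδ0 : 0 < δ) (hδ1 : δ < 1)
    (f0 f1 f2 : ℝ)
    (hf0 : f0 = 1 / (U : ℝ) ^ 2) (hf1 : f1 = 2 * m / (U : ℝ) ^ 2)
    (hf2 : f2 = m ^ 2 / (U : ℝ) ^ 2) :
    (r * δ ≥ (f2 / f0 - 1) * (m ^ 2 / (f2 * lam + m ^ 2)) * (r * (2 - δ)) /
      (1 + 2 * f2 * (f1 * lam + 2 * m) * m / (f1 * (f2 * lam + m ^ 2)) +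
        f2 * (f0 * lam + 1) * m ^ 2 / (f0 * (f2 * lam + m ^ 2)))) ↔
    δ ≥ (m ^ 2 - 1) * (2 - δ) / ((1 + lam / (U : ℝ) ^ 2) * (m + 1) ^ 2) := by
  have hU' : (2 : ℝ) ≤ U := by exact_mod_cast hU
  have hUpos : (0 : ℝ) < U := by linarith
  have hmpos : 0 < m := by linarith
  have hU2 : (0 : ℝ) < (U : ℝ) ^ 2 := by positivity
  clear hm hU hU'
  generalize (U : ℝ) ^ 2 = V at *
  have hs : 0 < 1 + lam / V := by positivity
  have h_ratio : f2 / f0 = m ^ 2 := by subst hf0 hf2; field_simp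
  have h_den : f2 * lam + m ^ 2 = m ^ 2 * (1 + lam / V) := by subst hf2; ring
  have h_first : 2 * f2 * (f1 * lam + 2 * m) * m / (f1 * (m ^ 2 * (1 + lam / V))) = 2 * m := by
    have h : f1 * lam + 2 * m = 2 * m * (1 + lam / V) := by subst hf1; ring
    rw [h]
    generalize 1 + lam / V = s at *
    subst hf1 hf2
    field_simp
  have h_second : f2 * (f0 * lam + 1) * m ^ 2 / (f0 * (m ^ 2 * (1 + lam / V))) = m ^ 2 := by
    have h : f0 * lam + 1 = 1 + lam / V := by subst hf0; ring
    rw [h]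
    generalize 1 + lam / V = s at *
    subst hf0 hf2
    field_simp
  rw [h_ratio, h_den, h_first, h_second]
  generalize 1 + lam / V = s at *
  have h_rhs : (m ^ 2 - 1) * (m ^ 2 / (m ^ 2 * s)) * (r * (2 - δ)) / (1 + 2 * m + m ^ 2) =
      r * ((m ^ 2 - 1) * (2 - δ) / (s * (m + 1) ^ 2)) := by
    rw [show 1 + 2 * m + m ^ 2 = (m + 1) ^ 2 by ring]
    field_simp
  rw [h_rhs, ge_iff_le, ge_iff_le, mul_le_mul_iff_right₀ hr]
end

section
/- Fix a natural number U ≥ 1 and real numbers δ, σ_e, σ_w, T with 0 < δ < 1, σ_e > 0, σ_w > 0, T > 0. Define R : Fin U → Fin U → ℝ by R(i,j) = 1 if i = 0 and j = 0, R(i,j) = 1 − δ if i ≠ 0 and j ≠ 0, and R(i,j) = 0 otherwise. For parameters W : Matrix (Fin U) (Fin U) ℝ, b c : Fin U → ℝ, d : ℝ, let q(i,j) = W i j + b i + c j + d and define the objective J(W,b,c,d) = −(T/(2·σ_e²))·(1/U)·∑_{i ∈ Fin U} (q(i,i) − R(i,i))² − (1/(2·σ_w²))·∑_{i,j ∈ Fin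 U} (W i j)². Then the parameters W* = 0, b* = δ·(indicator function of {0} on Fin U), c* = 0, d* = 1 − δ satisfy J(W*,b*,c*,d*) ≥ J(W,b,c,d) for all parameters (W,b,c,d), and the corresponding Q-function q*(i,j) = b* i + c* j + d* is equivalently optimal: q*(0,0) = max over all (i,j) ∈ Fin U × Fin U of q*(i,j). -/
theorem stmt_7 (U : ℕ) (hU : 0 < U) (δ σe σw T : ℝ)
    (hδ0 : 0 < δ) (hδ1 : δ < 1) (hσe : 0 < σe) (hσw : 0 < σw) (hT : 0 < T)
    (z : Fin U) (hz : z = ⟨0, hU⟩)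
    (R : Fin U → Fin U → ℝ)
    (hR : ∀ i j, R i j =
      if i = z ∧ j = z then 1 else if i ≠ z ∧ j ≠ z then 1 - δ else 0)
    (J : Matrix (Fin U) (Fin U) ℝ → (Fin U → ℝ) → (Fin U → ℝ) → ℝ → ℝ)
    (hJ : ∀ (W : Matrix (Fin U) (Fin U) ℝ) (b c : Fin U → ℝ) (d : ℝ),
      J W b c d =
        -(T / (2 * σe ^ 2)) * (1 / (U : ℝ)) *
            ∑ i, (W i i + b i + c i + d - R i i) ^ 2 -
          (1 / (2 * σw ^ 2)) * ∑ i, ∑ j, (W i j) ^ 2)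
    (Wstar : Matrix (Fin U) (Fin U) ℝ) (hW : Wstar = 0)
    (bstar cstar : Fin U → ℝ)
    (hb : bstar = fun i => if i = z then δ else 0) (hc : cstar = 0)
    (dstar : ℝ) (hd : dstar = 1 - δ)
    (qstar : Fin U → Fin U → ℝ)
    (hq : ∀ i j, qstar i j = bstar i + cstar j + dstar) :
    (∀ (W : Matrix (Fin U) (Fin U) ℝ) (b c : Fin U → ℝ) (d : ℝ),
      J Wstar bstar cstar dstar ≥ J W b c d) ∧
    IsGreatest {x : ℝ | ∃ i j : Fin U, x = qstar i j} (qstar z z) := by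
  subst hW hb hc hd
  refine ⟨fun W b c d => ?_, ⟨z, z, rfl⟩, ?_⟩
  · have h_opt : J 0 (fun i => if i = z then δ else 0) 0 (1 - δ) = 0 := by
      have h_fit : ∀ i, ((0 : Matrix (Fin U) (Fin U) ℝ) i i + (if i = z then δ else 0)
          + (0 : Fin U → ℝ) i + (1 - δ) - R i i) ^ 2 = 0 := by
        intro i
        by_cases h : i = z <;> simp [hR, h]
      rw [hJ, Finset.sum_eq_zero fun i _ => h_fit i]
      simp
    rw [h_opt, hJ]
    have h_likelihood : 0 ≤ T / (2 * σe ^ 2) * (1 / (U : ℝ)) *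
        ∑ i, (W i i + b i + c i + d - R i i) ^ 2 := by positivity
    have h_prior : 0 ≤ 1 / (2 * σw ^ 2) * ∑ i, ∑ j, (W i j) ^ 2 := by positivity
    linarith
  · rintro x ⟨i, j, rfl⟩
    simp only [hq, Pi.zero_apply, if_true]
    split_ifs <;> linarith
end

section
/- Let (α, μ) be a measure space and let p, q : α → ℝ be measurable functions with p(x) ≥ 0 and 0 < q(x) ≤ 1 for all x. Let ε be a real number with 0 < ε ≤ 1 and N a natural number with ε·N > 16. Assume p is integrable with respect to μ and the function x ↦ p(x)·(log(1/q(x)) + 2·q(x) + 16) is integrable with respect to μ. Then ∫ p(x)·(1 − ε·q(x))^N dμ(x) ≤ (2/log(ε·N)) · ∫ p(x)·(log(1/q(x)) + 2·q(x) + 16) dμ(x). -/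
open MeasureTheory

/-- Splitting `log M = log (1 / t) + log (M * t)` bounds `log M * exp (-(M * t))`
uniformly in `M`. -/
theorem log_mul_exp_neg_mul_le {M t : ℝ} (hM : 0 < M) (ht0 : 0 < t) (ht1 : t ≤ 1) :
    Real.log M * Real.exp (-(M * t)) ≤ Real.log (1 / t) + 1 := by
  have hs : 0 < M * t := mul_pos hM ht0
  have hsplit : Real.log M = Real.log (1 / t) + Real.log (M * t) := by
    rw [Real.log_mul hM.ne' ht0.ne', one_div, Real.log_inv]
    ring
  have hlog : 0 ≤ Real.log (1 / t) := Real.log_nonneg (one_le_one_div ht0 ht1)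
  have hexp : Real.exp (-(M * t)) ≤ 1 := Real.exp_le_one_iff.2 (by linarith)
  have hle : Real.log (M * t) ≤ Real.exp (M * t) :=
    (Real.log_le_self hs.le).trans (by linarith [Real.add_one_le_exp (M * t)])
  have hbound : Real.log (M * t) * Real.exp (-(M * t)) ≤ 1 := by
    calc Real.log (M * t) * Real.exp (-(M * t))
        ≤ Real.exp (M * t) * Real.exp (-(M * t)) := by gcongr
      _ = 1 := by rw [← Real.exp_add, add_neg_cancel, Real.exp_zero]
  rw [hsplit, add_mul]
  exact add_le_add (mul_le_of_le_one_right hlog hexp) hbound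

theorem one_sub_mul_pow_le_div_log {ε t : ℝ} {N : ℕ} (hε1 : ε ≤ 1)
    (hN : 1 < ε * N) (ht0 : 0 < t) (ht1 : t ≤ 1) :
    (1 - ε * t) ^ N ≤ (Real.log (1 / t) + 1) / Real.log (ε * N) := by
  have hpow : (1 - ε * t) ^ N ≤ Real.exp (-(ε * N * t)) := by
    calc (1 - ε * t) ^ N ≤ Real.exp (-(ε * t)) ^ N :=
          pow_le_pow_left₀ (sub_nonneg.2 (mul_le_one₀ hε1 ht0.le ht1))
            (Real.one_sub_le_exp_neg _) N
      _ = Real.exp (-(ε * N * t)) := by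
          rw [← Real.exp_nat_mul]
          ring_nf
  rw [le_div_iff₀' (Real.log_pos hN)]
  exact (mul_le_mul_of_nonneg_left hpow (Real.log_pos hN).le).trans
    (log_mul_exp_neg_mul_le (by linarith) ht0 ht1)

theorem stmt_8 {α : Type*} [MeasurableSpace α] (μ : Measure α) (p q : α → ℝ)
    (hp : Measurable p) (hq : Measurable q)
    (hp0 : ∀ x, 0 ≤ p x) (hq0 : ∀ x, 0 < q x) (hq1 : ∀ x, q x ≤ 1)
    (ε : ℝ) (hε0 : 0 < ε) (hε1 : ε ≤ 1) (N : ℕ) (hN : 16 < ε * N)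
    (hint1 : Integrable p μ)
    (hint2 : Integrable (fun x => p x * (Real.log (1 / q x) + 2 * q x + 16)) μ) :
    ∫ x, p x * (1 - ε * q x) ^ N ∂μ ≤
      (2 / Real.log (ε * N)) * ∫ x, p x * (Real.log (1 / q x) + 2 * q x + 16) ∂μ := by
  have hM : 1 < ε * N := by linarith
  have hL := Real.log_pos hM
  rw [← integral_const_mul]
  refine integral_mono_of_nonneg (.of_forall fun x => ?_) (hint2.const_mul _)
    (.of_forall fun x => ?_)
  · exact mul_nonneg (hp0 x)
      (pow_nonneg (sub_nonneg.2 (mul_le_one₀ hε1 (hq0 x).le (hq1 x))) N)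
  · have hlog : 0 ≤ Real.log (1 / q x) := Real.log_nonneg (one_le_one_div (hq0 x) (hq1 x))
    calc p x * (1 - ε * q x) ^ N
        ≤ p x * ((Real.log (1 / q x) + 1) / Real.log (ε * N)) :=
          mul_le_mul_of_nonneg_left
            (one_sub_mul_pow_le_div_log hε1 hM (hq0 x) (hq1 x)) (hp0 x)
      _ ≤ p x * (2 * (Real.log (1 / q x) + 2 * q x + 16) / Real.log (ε * N)) :=
          mul_le_mul_of_nonneg_left
            (div_le_div_of_nonneg_right (by linarith [hq0 x]) hL.le) (hp0 x)
      _ = 2 / Real.log (ε * N) * (p x * (Real.log (1 / q x) + 2 * q x + 16)) := by ring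
end

section
/- Let ε be a real number with 0 < ε ≤ 1, let N be a natural number with ε·N > 16, and let x be a real number with 0 < x ≤ 1. Then (1 − ε·x)^N ≤ 2·(log(1/x) + 2·x + 16)/log(ε·N). -/
theorem exp_neg_mul_mul_log_le {k x : ℝ} (hk : 0 < k) (hx0 : 0 < x) (hx1 : x ≤ 1) :
    Real.exp (-(k * x)) * Real.log k ≤ Real.log (1 / x) + 1 := by
  have hlog : Real.log k = Real.log (k * x) + Real.log (1 / x) := by
    rw [Real.log_mul hk.ne' hx0.ne', one_div, Real.log_inv]
    ring
  have hx : 0 ≤ Real.log (1 / x) := Real.log_nonneg (one_le_one_div hx0 hx1)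
  have hkx : Real.log (k * x) ≤ Real.exp (k * x) := by
    linarith [Real.log_le_sub_one_of_pos (mul_pos hk hx0), Real.add_one_le_exp (k * x)]
  have h₁ : Real.exp (-(k * x)) * Real.log (k * x) ≤ 1 := by
    calc Real.exp (-(k * x)) * Real.log (k * x)
        ≤ Real.exp (-(k * x)) * Real.exp (k * x) := by gcongr
      _ = 1 := by rw [← Real.exp_add, neg_add_cancel, Real.exp_zero]
  have h₂ : Real.exp (-(k * x)) * Real.log (1 / x) ≤ Real.log (1 / x) :=
    mul_le_of_le_one_left hx (Real.exp_le_one_iff.mpr (neg_nonpos.mpr (mul_pos hk hx0).le))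
  rw [hlog, mul_add]
  linarith

theorem one_sub_pow_le_exp_neg_mul {a : ℝ} (ha : a ≤ 1) (N : ℕ) :
    (1 - a) ^ N ≤ Real.exp (-(N * a)) := by
  rw [← mul_neg, Real.exp_nat_mul]
  exact pow_le_pow_left₀ (sub_nonneg.mpr ha) (Real.one_sub_le_exp_neg a) N

theorem stmt_9 (ε : ℝ) (hε0 : 0 < ε) (hε1 : ε ≤ 1) (N : ℕ) (hN : 16 < ε * N)
    (x : ℝ) (hx0 : 0 < x) (hx1 : x ≤ 1) :
    (1 - ε * x) ^ N ≤ 2 * (Real.log (1 / x) + 2 * x + 16) / Real.log (ε * N) := by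
  have hk : 0 < Real.log (ε * N) := Real.log_pos (by linarith)
  have hx : 0 ≤ Real.log (1 / x) := Real.log_nonneg (one_le_one_div hx0 hx1)
  rw [le_div_iff₀ hk]
  calc (1 - ε * x) ^ N * Real.log (ε * N)
      ≤ Real.exp (-(N * (ε * x))) * Real.log (ε * N) := by
        gcongr
        exact one_sub_pow_le_exp_neg_mul (mul_le_one₀ hε1 hx0.le hx1) N
    _ = Real.exp (-(ε * N * x)) * Real.log (ε * N) := by ring_nf
    _ ≤ Real.log (1 / x) + 1 := exp_neg_mul_mul_log_le (by linarith) hx0 hx1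
    _ ≤ 2 * (Real.log (1 / x) + 2 * x + 16) := by linarith
end

section
/- Fix real numbers T, σ_e, σ_w, f0, f1, f2, m, r, δ with T > 0, σ_e > 0, σ_w > 0, f0 > 0, f1 > 0, f2 > 0, m > 0, r > 0 and 0 < δ < 1, and set λ = T·σ_w²/σ_e². Define J : ℝ⁶ → ℝ by J(W0, W1, W2, B, C, D) = −(T/(2σ_e²))·[ f0·(W0 + 2B + D − r)² + f1·(W1 + B + C + D)² + f2·(W2 + 2C + D − r·(1−δ))² ] − (1/(2σ_w²))·[ W0² + 2m·W1² + m²·W2² ]. Suppose all six partial derivatives of J vanish at (W0, W1, W2, B, C, D), and write K2 = 2C + D − r·(1−δ). Then W0 + 2B + D ≥ W2 + 2C + D if and only if r·δ ≥ (f2/f0 − 1) · (m²/(f2·λ + m²)) · r·(2 − δ) / (1 + 2·f2·(f1·λ + 2m)·m/(f1·(f2·λ + m²)) + f2·(f0·λ + 1)·m²/(f0·(f2·λ + m²))). -/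
theorem HasDerivAt.quadratic_stationary {g : ℝ → ℝ} {x : ℝ} (a b c : ℝ)
    (h : HasDerivAt g 0 x) (hg : ∀ y, g y = a * y ^ 2 + b * y + c) :
    2 * a * x + b = 0 := by
  have hd : HasDerivAt (fun y => a * y ^ 2 + b * y + c) (a * (2 * x) + b) x := by
    simpa using (((hasDerivAt_pow 2 x).const_mul a).add
      ((hasDerivAt_id x).const_mul b)).add_const c
  rw [funext hg] at h
  linarith [h.unique hd]


theorem stmt_10 (T σe σw f0 f1 f2 m r δ : ℝ)
    (hT : 0 < T) (hσe : 0 < σe) (hσw : 0 < σw)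
    (hf0 : 0 < f0) (hf1 : 0 < f1) (hf2 : 0 < f2)
    (hm : 0 < m) (hr : 0 < r) (hδ0 : 0 < δ) (hδ1 : δ < 1)
    (lam : ℝ) (hlam : lam = T * σw ^ 2 / σe ^ 2)
    (J : ℝ → ℝ → ℝ → ℝ → ℝ → ℝ → ℝ)
    (hJ : ∀ W0 W1 W2 B C D, J W0 W1 W2 B C D =
      -(T / (2 * σe ^ 2)) *
        (f0 * (W0 + 2 * B + D - r) ^ 2 + f1 * (W1 + B + C + D) ^ 2 +
          f2 * (W2 + 2 * C + D - r * (1 - δ)) ^ 2) -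
      (1 / (2 * σw ^ 2)) * (W0 ^ 2 + 2 * m * W1 ^ 2 + m ^ 2 * W2 ^ 2))
    (W0 W1 W2 B C D : ℝ)
    (hdW0 : HasDerivAt (fun x => J x W1 W2 B C D) 0 W0)
    (hdW1 : HasDerivAt (fun x => J W0 x W2 B C D) 0 W1)
    (hdW2 : HasDerivAt (fun x => J W0 W1 x B C D) 0 W2)
    (hdB : HasDerivAt (fun x => J W0 W1 W2 x C D) 0 B)
    (hdC : HasDerivAt (fun x => J W0 W1 W2 B x D) 0 C)
    (hdD : HasDerivAt (fun x => J W0 W1 W2 B C x) 0 D)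
    (K2 : ℝ) (hK2 : K2 = 2 * C + D - r * (1 - δ)) :
    (W0 + 2 * B + D ≥ W2 + 2 * C + D ↔
      r * δ ≥ (f2 / f0 - 1) * (m ^ 2 / (f2 * lam + m ^ 2)) * (r * (2 - δ)) /
        (1 + 2 * f2 * (f1 * lam + 2 * m) * m / (f1 * (f2 * lam + m ^ 2)) +
          f2 * (f0 * lam + 1) * m ^ 2 / (f0 * (f2 * lam + m ^ 2)))) := by
  have hlam0 : 0 < lam := by rw [hlam]; positivity
  obtain ⟨k, hk_def⟩ : ∃ k, k = T / (2 * σe ^ 2) := ⟨_, rfl⟩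
  obtain ⟨w, hw_def⟩ : ∃ w, w = 1 / (2 * σw ^ 2) := ⟨_, rfl⟩
  have hw : 0 < w := by rw [hw_def]; positivity
  have hk0 : 0 < k := by rw [hk_def]; positivity
  have hkw : k = lam * w := by rw [hk_def, hw_def, hlam]; field_simp
  simp only [← hk_def, ← hw_def] at hJ
  have eW0 := hdW0.quadratic_stationary (-k * f0 - w) (-2 * k * f0 * (2 * B + D - r))
    (J 0 W1 W2 B C D) (fun y => by simp only [hJ]; ring)
  have eW1 := hdW1.quadratic_stationary (-k * f1 - 2 * m * w) (-2 * k * f1 * (B + C + D))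
    (J W0 0 W2 B C D) (fun y => by simp only [hJ]; ring)
  have eW2 := hdW2.quadratic_stationary (-k * f2 - m ^ 2 * w)
    (-2 * k * f2 * (2 * C + D - r * (1 - δ)))
    (J W0 W1 0 B C D) (fun y => by simp only [hJ]; ring)
  have eB := hdB.quadratic_stationary (-k * (4 * f0 + f1))
    (-2 * k * (2 * f0 * (W0 + D - r) + f1 * (W1 + C + D)))
    (J W0 W1 W2 0 C D) (fun y => by simp only [hJ]; ring)
  have eC := hdC.quadratic_stationary (-k * (f1 + 4 * f2))
    (-2 * k * (f1 * (W1 + B + D) + 2 * f2 * (W2 + D - r * (1 - δ))))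
    (J W0 W1 W2 B 0 D) (fun y => by simp only [hJ]; ring)
  obtain ⟨s, hs⟩ : ∃ s, s = f0 * (W0 + 2 * B + D - r) := ⟨_, rfl⟩
  have h1 : f1 * (W1 + B + C + D) = -2 * s :=
    mul_left_cancel₀ hk0.ne' (by rw [hs]; linear_combination (-1 / 2) * eB)
  have h2 : f2 * (W2 + 2 * C + D - r * (1 - δ)) = s :=
    mul_left_cancel₀ hk0.ne' (by linear_combination (-1 / 4) * eC - (k / 2) * h1)
  have hW0 : W0 = -lam * s :=
    mul_left_cancel₀ hw.ne' (by linear_combination (-1 / 2) * eW0 + k * hs - s * hkw)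
  have hW1 : m * W1 = lam * s :=
    mul_left_cancel₀ hw.ne' (by linear_combination (-1 / 4) * eW1 - (k / 2) * h1 + s * hkw)
  have hW2 : m ^ 2 * W2 = -lam * s :=
    mul_left_cancel₀ hw.ne' (by linear_combination (-1 / 2) * eW2 - k * h2 - s * hkw)
  have e0 : W0 + 2 * B + D - r = s / f0 := by rw [eq_div_iff hf0.ne']; linarith
  have e1 : W1 + B + C + D = -2 * s / f1 := by rw [eq_div_iff hf1.ne']; linarith
  have e2 : W2 + 2 * C + D - r * (1 - δ) = s / f2 := by rw [eq_div_iff hf2.ne']; linarith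
  have w1 : W1 = lam * s / m := by rw [eq_div_iff hm.ne']; linarith
  have w2 : W2 = -lam * s / m ^ 2 := by rw [eq_div_iff (by positivity)]; linarith
  obtain ⟨X, hX⟩ : ∃ X, X = 1 / f0 + 1 / f2 + 4 / f1 + lam * (1 + 2 / m + 1 / m ^ 2) := ⟨_, rfl⟩
  have hX0 : 0 < X := by rw [hX]; positivity
  have hsX : s * X = -(r * (2 - δ)) := by
    rw [hX]
    linear_combination hW0 + w2 - 2 * w1 - e0 - e2 + 2 * e1
  have hY : 1 + 2 * f2 * (f1 * lam + 2 * m) * m / (f1 * (f2 * lam + m ^ 2)) +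
      f2 * (f0 * lam + 1) * m ^ 2 / (f0 * (f2 * lam + m ^ 2)) =
      X * (f2 * m ^ 2 / (f2 * lam + m ^ 2)) := by
    rw [hX]
    field_simp
    ring
  have hgap : (f2 / f0 - 1) * (m ^ 2 / (f2 * lam + m ^ 2)) * (r * (2 - δ)) /
      (X * (f2 * m ^ 2 / (f2 * lam + m ^ 2))) = s / f2 - s / f0 := by
    rw [show r * (2 - δ) = -(s * X) by linarith]
    field_simp
    ring
  rw [hY, hgap, ← e0, ← e2]
  constructor <;> intro h <;> linarith
end

section
/- Fix real numbers T, σ_e, σ_w, f0, f1, f2, m, r, δ with T > 0, σ_e > 0, σ_w > 0, f0 > 0, f1 > 0, f2 > 0, m > 0, r > 0 and 0 < δ < 1, and set λ = T·σ_w²/σ_e². Define J : ℝ⁶ → ℝ by J(W0, W1, W2, B, C, D) = −(T/(2σ_e²))·[ f0·(W0 + 2B + D − r)² + f1·(W1 + B + C + D)² + f2·(W2 + 2C + D − r·(1−δ))² ] − (1/(2σ_w²))·[ W0² + 2m·W1² + m²·W2² ]. Suppose all six partial derivatives of J vanish at (W0, W1, W2, B, C, D), and write K2 = 2C + D − r·(1−δ).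 Then K2 · (1 + 2·f2·(f1·λ + 2m)·m/(f1·(f2·λ + m²)) + f2·(f0·λ + 1)·m²/(f0·(f2·λ + m²))) = −r·(2 − δ). -/
theorem stationary_of_eq_quadratic {f : ℝ → ℝ} {x : ℝ} (p q : ℝ)
    (hf : ∀ y, f y = p * y ^ 2 + q * y + f 0) (h : HasDerivAt f 0 x) :
    2 * p * x + q = 0 := by
  have h' : HasDerivAt (fun y => p * y ^ 2 + q * y + f 0) (p * (2 * x) + q) x := by
    simpa using ((((hasDerivAt_id x).pow 2).const_mul p).add
      ((hasDerivAt_id x).const_mul q)).add_const (f 0)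
  rw [← funext hf] at h'
  linarith [h.unique h']

theorem stmt_11 (T σe σw f0 f1 f2 m r δ : ℝ)
    (hT : 0 < T) (hσe : 0 < σe) (hσw : 0 < σw)
    (hf0 : 0 < f0) (hf1 : 0 < f1) (hf2 : 0 < f2)
    (hm : 0 < m) (hr : 0 < r) (hδ0 : 0 < δ) (hδ1 : δ < 1)
    (lam : ℝ) (hlam : lam = T * σw ^ 2 / σe ^ 2)
    (J : ℝ → ℝ → ℝ → ℝ → ℝ → ℝ → ℝ)
    (hJ : ∀ W0 W1 W2 B C D, J W0 W1 W2 B C D =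
      -(T / (2 * σe ^ 2)) *
        (f0 * (W0 + 2 * B + D - r) ^ 2 + f1 * (W1 + B + C + D) ^ 2 +
          f2 * (W2 + 2 * C + D - r * (1 - δ)) ^ 2) -
      (1 / (2 * σw ^ 2)) * (W0 ^ 2 + 2 * m * W1 ^ 2 + m ^ 2 * W2 ^ 2))
    (W0 W1 W2 B C D : ℝ)
    (hdW0 : HasDerivAt (fun x => J x W1 W2 B C D) 0 W0)
    (hdW1 : HasDerivAt (fun x => J W0 x W2 B C D) 0 W1)
    (hdW2 : HasDerivAt (fun x => J W0 W1 x B C D) 0 W2)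
    (hdB : HasDerivAt (fun x => J W0 W1 W2 x C D) 0 B)
    (hdC : HasDerivAt (fun x => J W0 W1 W2 B x D) 0 C)
    (hdD : HasDerivAt (fun x => J W0 W1 W2 B C x) 0 D)
    (K2 : ℝ) (hK2 : K2 = 2 * C + D - r * (1 - δ)) :
    K2 * (1 + 2 * f2 * (f1 * lam + 2 * m) * m / (f1 * (f2 * lam + m ^ 2)) +
        f2 * (f0 * lam + 1) * m ^ 2 / (f0 * (f2 * lam + m ^ 2))) = -(r * (2 - δ)) := by
  have hσe' := hσe.ne'
  have hσw' := hσw.ne'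
  have hm' := hm.ne'
  have hf0' := hf0.ne'
  have hf1' := hf1.ne'
  have hf2' := hf2.ne'
  have hlam_pos : 0 < lam := by rw [hlam]; positivity
  have hden : f2 * lam + m ^ 2 ≠ 0 := by positivity
  have eW0 := stationary_of_eq_quadratic
    (-(T / (2 * σe ^ 2)) * f0 - 1 / (2 * σw ^ 2))
    (-(T / σe ^ 2) * (f0 * (2 * B + D - r)))
    (fun y => by simp only [hJ]; ring) hdW0
  have eW1 := stationary_of_eq_quadratic
    (-(T / (2 * σe ^ 2)) * f1 - 1 / (2 * σw ^ 2) * (2 * m))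
    (-(T / σe ^ 2) * (f1 * (B + C + D)))
    (fun y => by simp only [hJ]; ring) hdW1
  have eW2 := stationary_of_eq_quadratic
    (-(T / (2 * σe ^ 2)) * f2 - 1 / (2 * σw ^ 2) * m ^ 2)
    (-(T / σe ^ 2) * (f2 * (2 * C + D - r * (1 - δ))))
    (fun y => by simp only [hJ]; ring) hdW2
  have eB := stationary_of_eq_quadratic
    (-(T / (2 * σe ^ 2)) * (4 * f0 + f1))
    (-(T / σe ^ 2) * (2 * f0 * (W0 + D - r) + f1 * (W1 + C + D)))
    (fun y => by simp only [hJ]; ring) hdB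
  have eC := stationary_of_eq_quadratic
    (-(T / (2 * σe ^ 2)) * (f1 + 4 * f2))
    (-(T / σe ^ 2) * (f1 * (W1 + B + D) + 2 * f2 * (W2 + D - r * (1 - δ))))
    (fun y => by simp only [hJ]; ring) hdC
  have hT' : T / σe ^ 2 ≠ 0 := by positivity
  have hlam' : T / σe ^ 2 * σw ^ 2 = lam := by rw [hlam]; ring
  have hσ : σw ^ 2 * (1 / σw ^ 2) = 1 := by field_simp
  obtain ⟨s, hs⟩ : ∃ s, s = f2 * (W2 + K2) := ⟨_, rfl⟩
  have h1 : f1 * (W1 + B + C + D) = -2 * s := by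
    apply mul_left_cancel₀ hT'
    rw [hs, hK2]
    linear_combination -eC
  have h0 : f0 * (W0 + 2 * B + D - r) = s := by
    apply mul_left_cancel₀ hT'
    linear_combination -eB / 2 - T / σe ^ 2 * h1 / 2
  have w0 : W0 = -lam * s := by
    linear_combination -σw ^ 2 * eW0 - W0 * hσ -
      f0 * (W0 + 2 * B + D - r) * hlam' - lam * h0
  have w1 : m * W1 = lam * s := by
    linear_combination -σw ^ 2 * eW1 / 2 - m * W1 * hσ -
      f1 * (W1 + B + C + D) * hlam' / 2 - lam * h1 / 2
  have w2 : m ^ 2 * W2 = -lam * s := by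
    rw [hK2] at hs
    linear_combination -σw ^ 2 * eW2 - m ^ 2 * W2 * hσ -
      f2 * (W2 + 2 * C + D - r * (1 - δ)) * hlam' + lam * hs
  have k0 : 2 * B + D - r = s / f0 + lam * s := by
    field_simp
    linear_combination h0 - f0 * w0
  have k1 : B + C + D = -2 * s / f1 - lam * s / m := by
    field_simp
    linear_combination m * h1 - f1 * w1
  have k2 : s = K2 * f2 * m ^ 2 / (f2 * lam + m ^ 2) := by
    field_simp
    linear_combination m ^ 2 * hs + f2 * w2
  have key : K2 + s * (2 * lam / m + 4 / f1) + s * (lam + 1 / f0) = -(r * (2 - δ)) := by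
    linear_combination hK2 - k0 + 2 * k1
  rw [← key, k2]
  field_simp
  ring
end

section
/- Fix real numbers T, σ_e, σ_w, f0, f1, f2, m, r, δ with T > 0, σ_e > 0, σ_w > 0, f0 > 0, f1 > 0, f2 > 0, m > 0, r > 0 and 0 < δ < 1, and set λ = T·σ_w²/σ_e². Define J : ℝ⁶ → ℝ by J(W0, W1, W2, B, C, D) = −(T/(2σ_e²))·[ f0·(W0 + 2B + D − r)² + f1·(W1 + B + C + D)² + f2·(W2 + 2C + D − r·(1−δ))² ] − (1/(2σ_w²))·[ W0² + 2m·W1² + m²·W2² ]. If all six partial derivatives of J vanish at (W0, W1, W2, B, C, D), then W0 = −m·W1 and W1 = −m·W2. -/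
/-- The linear equation satisfied by a critical point of a univariate quadratic. -/
theorem quadratic_critical_point {g : ℝ → ℝ} {x : ℝ} (p q c : ℝ)
    (hg : ∀ y, g y = p * y ^ 2 + q * y + c) (h : HasDerivAt g 0 x) :
    2 * p * x + q = 0 := by
  have hd : HasDerivAt (fun y : ℝ => p * y ^ 2 + q * y + c)
      (p * (2 * x) + q * 1) x := by
    have h2 : HasDerivAt (fun y : ℝ => y ^ 2) (2 * x) x := by
      simpa using hasDerivAt_pow 2 x
    exact ((h2.const_mul p).add ((hasDerivAt_id x).const_mul q)).add_const c
  rw [← funext hg] at hd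
  linarith [hd.unique h]

theorem stmt_12 (T σe σw f0 f1 f2 m r δ : ℝ)
    (hT : 0 < T) (hσe : 0 < σe) (hσw : 0 < σw)
    (hf0 : 0 < f0) (hf1 : 0 < f1) (hf2 : 0 < f2)
    (hm : 0 < m) (hr : 0 < r) (hδ0 : 0 < δ) (hδ1 : δ < 1)
    (lam : ℝ) (hlam : lam = T * σw ^ 2 / σe ^ 2)
    (J : ℝ → ℝ → ℝ → ℝ → ℝ → ℝ → ℝ)
    (hJ : ∀ W0 W1 W2 B C D, J W0 W1 W2 B C D =
      -(T / (2 * σe ^ 2)) *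
        (f0 * (W0 + 2 * B + D - r) ^ 2 + f1 * (W1 + B + C + D) ^ 2 +
          f2 * (W2 + 2 * C + D - r * (1 - δ)) ^ 2) -
      (1 / (2 * σw ^ 2)) * (W0 ^ 2 + 2 * m * W1 ^ 2 + m ^ 2 * W2 ^ 2))
    (W0 W1 W2 B C D : ℝ)
    (hdW0 : HasDerivAt (fun x => J x W1 W2 B C D) 0 W0)
    (hdW1 : HasDerivAt (fun x => J W0 x W2 B C D) 0 W1)
    (hdW2 : HasDerivAt (fun x => J W0 W1 x B C D) 0 W2)
    (hdB : HasDerivAt (fun x => J W0 W1 W2 x C D) 0 B)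
    (hdC : HasDerivAt (fun x => J W0 W1 W2 B x D) 0 C)
    (hdD : HasDerivAt (fun x => J W0 W1 W2 B C x) 0 D)
    : W0 = -m * W1 ∧ W1 = -m * W2 := by
  have hs : 0 < 1 / (2 * σw ^ 2) := by positivity
  generalize T / (2 * σe ^ 2) = k at hJ
  generalize 1 / (2 * σw ^ 2) = s at hJ hs
  have eW0 := quadratic_critical_point (-k * f0 - s)
    (-k * (2 * f0 * (2 * B + D - r)))
    (-k * (f0 * (2 * B + D - r) ^ 2 + f1 * (W1 + B + C + D) ^ 2 +
      f2 * (W2 + 2 * C + D - r * (1 - δ)) ^ 2) -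
      s * (2 * m * W1 ^ 2 + m ^ 2 * W2 ^ 2))
    (fun y => by rw [hJ]; ring) hdW0
  have eW1 := quadratic_critical_point (-k * f1 - s * (2 * m))
    (-k * (2 * f1 * (B + C + D)))
    (-k * (f0 * (W0 + 2 * B + D - r) ^ 2 + f1 * (B + C + D) ^ 2 +
      f2 * (W2 + 2 * C + D - r * (1 - δ)) ^ 2) -
      s * (W0 ^ 2 + m ^ 2 * W2 ^ 2))
    (fun y => by rw [hJ]; ring) hdW1
  have eW2 := quadratic_critical_point (-k * f2 - s * m ^ 2)
    (-k * (2 * f2 * (2 * C + D - r * (1 - δ))))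
    (-k * (f0 * (W0 + 2 * B + D - r) ^ 2 + f1 * (W1 + B + C + D) ^ 2 +
      f2 * (2 * C + D - r * (1 - δ)) ^ 2) -
      s * (W0 ^ 2 + 2 * m * W1 ^ 2))
    (fun y => by rw [hJ]; ring) hdW2
  have eB := quadratic_critical_point (-k * (4 * f0 + f1))
    (-k * (4 * f0 * (W0 + D - r) + 2 * f1 * (W1 + C + D)))
    (-k * (f0 * (W0 + D - r) ^ 2 + f1 * (W1 + C + D) ^ 2 +
      f2 * (W2 + 2 * C + D - r * (1 - δ)) ^ 2) -
      s * (W0 ^ 2 + 2 * m * W1 ^ 2 + m ^ 2 * W2 ^ 2))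
    (fun y => by rw [hJ]; ring) hdB
  have eC := quadratic_critical_point (-k * (f1 + 4 * f2))
    (-k * (2 * f1 * (W1 + B + D) + 4 * f2 * (W2 + D - r * (1 - δ))))
    (-k * (f0 * (W0 + 2 * B + D - r) ^ 2 + f1 * (W1 + B + D) ^ 2 +
      f2 * (W2 + D - r * (1 - δ)) ^ 2) -
      s * (W0 ^ 2 + 2 * m * W1 ^ 2 + m ^ 2 * W2 ^ 2))
    (fun y => by rw [hJ]; ring) hdC
  have h1 : s * (W0 + m * W1) = 0 := by linear_combination (eB - 2 * eW0 - eW1) / 4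
  have h2 : s * m * (W1 + m * W2) = 0 := by linear_combination (eC - 2 * eW2 - eW1) / 4
  have h3 := (mul_eq_zero.mp h1).resolve_left hs.ne'
  have h4 := (mul_eq_zero.mp h2).resolve_left (mul_pos hs hm).ne'
  constructor <;> linarith
end

section
/- Fix real numbers T, σ_e, σ_w, f0, f1, f2, m, r, δ with T > 0, σ_e > 0, σ_w > 0, f0 > 0, f1 > 0, f2 > 0, m > 0, r > 0 and 0 < δ < 1, and set λ = T·σ_w²/σ_e². Define J : ℝ⁶ → ℝ by J(W0, W1, W2, B, C, D) = −(T/(2σ_e²))·[ f0·(W0 + 2B + D − r)² + f1·(W1 + B + C + D)² + f2·(W2 + 2C + D − r·(1−δ))² ] − (1/(2σ_w²))·[ W0² + 2m·W1² + m²·W2² ]. Suppose all six partial derivatives of J vanish at (W0, W1, W2, B, C, D), and write K0 = 2B + D − r, K1 = B + C + D, K2 = 2C + D − r·(1−δ). Then f0·(W0 + K0) = f2·(W2 + K2) and f1·(W1 + K1) = −2·f2·(W2 + K2). -/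
/-- The normal equation at a critical point of a one-variable weighted sum of three squared affine
residuals, up to a nonzero factor and an additive constant. -/
theorem weighted_residual_sum_eq_zero_of_hasDerivAt {k f₀ f₁ f₂ a₀ a₁ a₂ c₀ c₁ c₂ e x : ℝ}
    (hk : k ≠ 0)
    (h : HasDerivAt (fun x => k * (f₀ * (a₀ * x + c₀) ^ 2 + f₁ * (a₁ * x + c₁) ^ 2 +
      f₂ * (a₂ * x + c₂) ^ 2) - e) 0 x) :
    a₀ * (f₀ * (a₀ * x + c₀)) + a₁ * (f₁ * (a₁ * x + c₁)) + a₂ * (f₂ * (a₂ * x + c₂)) = 0 := by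
  have sq (f a c : ℝ) :
      HasDerivAt (fun x : ℝ => f * (a * x + c) ^ 2) (2 * (a * (f * (a * x + c)))) x := by
    refine (((((hasDerivAt_id' x).const_mul a).add_const c).pow 2).const_mul f).congr_deriv ?_
    push_cast
    ring
  have hd := ((((sq f₀ a₀ c₀).add (sq f₁ a₁ c₁)).add (sq f₂ a₂ c₂)).const_mul k).sub_const e
  have hz := (mul_eq_zero.mp (hd.unique h)).resolve_left hk
  linarith

theorem stmt_14 (T σe σw f0 f1 f2 m r δ : ℝ)
    (hT : 0 < T) (hσe : 0 < σe) (hσw : 0 < σw)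
    (hf0 : 0 < f0) (hf1 : 0 < f1) (hf2 : 0 < f2)
    (hm : 0 < m) (hr : 0 < r) (hδ0 : 0 < δ) (hδ1 : δ < 1)
    (lam : ℝ) (hlam : lam = T * σw ^ 2 / σe ^ 2)
    (J : ℝ → ℝ → ℝ → ℝ → ℝ → ℝ → ℝ)
    (hJ : ∀ W0 W1 W2 B C D, J W0 W1 W2 B C D =
      -(T / (2 * σe ^ 2)) *
        (f0 * (W0 + 2 * B + D - r) ^ 2 + f1 * (W1 + B + C + D) ^ 2 +
          f2 * (W2 + 2 * C + D - r * (1 - δ)) ^ 2) -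
      (1 / (2 * σw ^ 2)) * (W0 ^ 2 + 2 * m * W1 ^ 2 + m ^ 2 * W2 ^ 2))
    (W0 W1 W2 B C D : ℝ)
    (hdW0 : HasDerivAt (fun x => J x W1 W2 B C D) 0 W0)
    (hdW1 : HasDerivAt (fun x => J W0 x W2 B C D) 0 W1)
    (hdW2 : HasDerivAt (fun x => J W0 W1 x B C D) 0 W2)
    (hdB : HasDerivAt (fun x => J W0 W1 W2 x C D) 0 B)
    (hdC : HasDerivAt (fun x => J W0 W1 W2 B x D) 0 C)
    (hdD : HasDerivAt (fun x => J W0 W1 W2 B C x) 0 D)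
    (K0 K1 K2 : ℝ) (hK0 : K0 = 2 * B + D - r) (hK1 : K1 = B + C + D)
    (hK2 : K2 = 2 * C + D - r * (1 - δ)) :
    f0 * (W0 + K0) = f2 * (W2 + K2) ∧ f1 * (W1 + K1) = -2 * f2 * (W2 + K2) := by
  have hk : -(T / (2 * σe ^ 2)) ≠ 0 := neg_ne_zero.mpr (by positivity)
  set e := 1 / (2 * σw ^ 2) * (W0 ^ 2 + 2 * m * W1 ^ 2 + m ^ 2 * W2 ^ 2) with he
  have hB := weighted_residual_sum_eq_zero_of_hasDerivAt (f₀ := f0) (f₁ := f1) (f₂ := f2)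
    (a₀ := 2) (a₁ := 1) (a₂ := 0) (c₀ := W0 + D - r) (c₁ := W1 + C + D)
    (c₂ := W2 + 2 * C + D - r * (1 - δ)) (e := e) hk
    (hdB.congr_of_eventuallyEq (.of_forall fun x => by simp only [hJ, he]; ring))
  have hC := weighted_residual_sum_eq_zero_of_hasDerivAt (f₀ := f0) (f₁ := f1) (f₂ := f2)
    (a₀ := 0) (a₁ := 1) (a₂ := 2) (c₀ := W0 + 2 * B + D - r) (c₁ := W1 + B + D)
    (c₂ := W2 + D - r * (1 - δ)) (e := e) hk
    (hdC.congr_of_eventuallyEq (.of_forall fun x => by simp only [hJ, he]; ring))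
  subst hK0 hK1 hK2
  constructor <;> linarith
end

section
/- For all real numbers k and x with k > 16 and x > 0, exp(−k·x) ≤ log(1/x)/((1/2)·log k) + x/((1/2)·log k) + x/k. -/
theorem stmt_15 (k x : ℝ) (hk : 16 < k) (hx : 0 < x) :
    Real.exp (-(k * x)) ≤
      Real.log (1 / x) / ((1/2) * Real.log k) + x / ((1/2) * Real.log k) + x / k := by
  have hk0 : 0 < k := by linarith
  have hL : 0 < (1/2) * Real.log k := by
    have := Real.log_pos (show (1 : ℝ) < k by linarith)
    positivity
  have hxk : 0 ≤ x / k := by positivity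
  suffices h : Real.exp (-(k * x)) * ((1/2) * Real.log k) ≤ Real.log (1 / x) + x by
    have h' := (le_div_iff₀ hL).mpr h
    rw [add_div] at h'
    linarith
  have hlog : Real.log (1 / x) = -Real.log x := by rw [one_div, Real.log_inv]
  rw [hlog]
  have hsqrt : (1/2) * Real.log k = Real.log √k := by rw [Real.log_sqrt hk0.le]; ring
  have hs0 : 0 < √k := Real.sqrt_pos.mpr hk0
  have hss : √k * √k = k := Real.mul_self_sqrt hk0.le
  rcases le_total (√k * x) 1 with h | h
  · have h1 : Real.log (√k * x) ≤ 0 := Real.log_nonpos (by positivity) h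
    rw [Real.log_mul hs0.ne' hx.ne', ← hsqrt] at h1
    have h2 : Real.exp (-(k * x)) ≤ 1 := Real.exp_le_one_iff.mpr (by nlinarith)
    nlinarith
  · have h1 : √k ≤ k * x := by nlinarith
    have h2 : Real.log √k ≤ Real.exp (k * x) := by
      linarith [Real.log_le_sub_one_of_pos hs0, Real.add_one_le_exp (k * x)]
    have h3 : Real.exp (-(k * x)) * Real.log √k ≤ 1 := by
      rw [Real.exp_neg, inv_mul_le_iff₀ (Real.exp_pos _), mul_one]
      exact h2
    rw [hsqrt]
    linarith [Real.log_le_sub_one_of_pos hx]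
end

section
/- For all real numbers k and x with k > 16 and 0 < x ≤ 2·log k / k, it holds that log(1/x)/((1/2)·log k) ≥ exp(−k·x). -/
theorem stmt_17 (k x : ℝ) (hk : 16 < k) (hx0 : 0 < x) (hx1 : x ≤ 2 * Real.log k / k) :
    Real.log (1 / x) / ((1/2) * Real.log k) ≥ Real.exp (-(k * x)) := by
  have hk0 : 0 < k := by linarith
  have ht0 : 0 < k * x := mul_pos hk0 hx0
  have ht1 : k * x ≤ 2 * Real.log k := by
    rw [le_div_iff₀ hk0] at hx1
    linarith
  have hlog_two : Real.log 2 ≤ 1 := by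
    linarith [Real.log_le_sub_one_of_pos (show (0 : ℝ) < 2 by norm_num)]
  have hlog_two_pos : 0 < Real.log 2 := Real.log_pos (by norm_num)
  have hlog_k : 4 * Real.log 2 ≤ Real.log k := by
    have h : Real.log ((2 : ℝ) ^ 4) ≤ Real.log k :=
      Real.log_le_log (by norm_num) (by linarith)
    rw [Real.log_pow] at h
    exact_mod_cast h
  have hlog_x : Real.log (1 / x) = Real.log k - Real.log (k * x) := by
    rw [Real.log_mul hk0.ne' hx0.ne', one_div, Real.log_inv]
    ring
  rw [ge_iff_le, le_div_iff₀ (by linarith), hlog_x]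
  rcases le_total (k * x) 1 with h | h
  · have hexp : Real.exp (-(k * x)) ≤ 1 := Real.exp_le_one_iff.2 (by linarith)
    have hlog : Real.log (k * x) ≤ 0 := Real.log_nonpos ht0.le h
    nlinarith
  · have hexp : Real.exp (-(k * x)) ≤ 1 / 2 := by
      rw [Real.exp_neg, ← one_div]
      exact one_div_le_one_div_of_le two_pos (by linarith [Real.add_one_le_exp (k * x)])
    -- The tangent line of `log` at `8` bounds `log (k * x)`.
    have hlog : Real.log (k * x) ≤ k * x / 8 - 1 + 3 * Real.log 2 := by
      have h8 : Real.log (2 ^ 3 : ℝ) = 3 * Real.log 2 := by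
        rw [Real.log_pow]
        norm_num
      have htangent := Real.log_le_sub_one_of_pos (show 0 < k * x / 2 ^ 3 by positivity)
      rw [Real.log_div ht0.ne' (by norm_num), h8] at htangent
      linarith
    nlinarith
end

section
/- For all real numbers k and x with k > 16 and x > 0, exp(−k·x) ≤ 2·(log(1/x) + 2·x + 16)/log k. -/
theorem stmt_19 (k x : ℝ) (hk : 16 < k) (hx : 0 < x) :
    Real.exp (-(k * x)) ≤ 2 * (Real.log (1 / x) + 2 * x + 16) / Real.log k := by
  have hk0 : 0 < k := by linarith
  have hkx : 0 < k * x := mul_pos hk0 hx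
  rw [le_div_iff₀ (Real.log_pos (by linarith)), one_div, Real.log_inv]
  have hlog : Real.log k = Real.log (k * x) - Real.log x := by
    rw [Real.log_mul hk0.ne' hx.ne']; ring
  have hpos : 0 < Real.exp (-(k * x)) := Real.exp_pos _
  have hle : Real.exp (-(k * x)) ≤ 1 := Real.exp_le_one_iff.mpr (by linarith)
  have hlogx : Real.log x ≤ x - 1 := Real.log_le_sub_one_of_pos hx
  have hprod : Real.exp (-(k * x)) * Real.log (k * x) ≤ 1 := by
    calc Real.exp (-(k * x)) * Real.log (k * x)
        ≤ Real.exp (-(k * x)) * Real.exp (k * x) := by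
          gcongr
          linarith [Real.log_le_sub_one_of_pos hkx, Real.add_one_le_exp (k * x)]
      _ = 1 := by rw [← Real.exp_add, neg_add_cancel, Real.exp_zero]
  rw [hlog, mul_sub]
  rcases le_total 0 (Real.log x) with h | h
  · linarith [mul_nonneg hpos.le h]
  · linarith [mul_le_mul_of_nonpos_right hle h]
end
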